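/- Every normalized block basis (y_i) of the unit vector basis (e_i) of the Schlumprecht space S dominates (e_i): for all finitely supported scalar sequences (a_i), ‖Σ_{i=1}^∞ a_i y_i‖ ≥ ‖Σ_{i=1}^∞ a_i e_i‖. -/

import Mathlib

open Filter Topology

noncomputable section

/-- `f(t) = log₂(t+1)`. -/
def schF (t : ℝ) : ℝ := Real.logb 2 (t + 1)

/-- For a finitely supported scalar sequence `a`, the vector `Σᵢ aᵢ eᵢ`. -/
def embed {S : Type*} [NormedAddCommGroup S] [NormedSpace ℝ S] (e : ℕ → S) (a : ℕ →₀ ℝ) : S :=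
  a.sum fun i c => c • e i

/-- The restriction `Ex` of `x = Σ aᵢ eᵢ` to the coordinates in the finite set `E`. -/
def restr (a : ℕ →₀ ℝ) (E : Finset ℕ) : ℕ →₀ ℝ := a.filter (· ∈ E)

/-- `E₁ < E₂ < ⋯ < E_r` : a successive family of finite subsets of ℕ. -/
def Succ {r : ℕ} (E : Fin r → Finset ℕ) : Prop :=
  ∀ i j : Fin r, i < j → ∀ m ∈ E i, ∀ n ∈ E j, m < n

/-- `S` is (a realization of) the Schlumprecht space with unit vector basis `e`:
a Banach space in which the span of `e` is dense and whose norm satisfies, on the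
finitely supported vectors `Σ aᵢ eᵢ`, the implicit Schlumprecht equation. -/
structure IsSchlumprecht (S : Type*) [NormedAddCommGroup S] [NormedSpace ℝ S] (e : ℕ → S) :
    Prop where
  dense_span : Dense (Submodule.span ℝ (Set.range e) : Set S)
  norm_eq : ∀ a : ℕ →₀ ℝ,
    ‖embed e a‖ = max (⨆ i, |a i|)
      (sSup {c : ℝ | ∃ r : ℕ, 2 ≤ r ∧ ∃ E : Fin r → Finset ℕ, Succ E ∧
        c = (schF r)⁻¹ * ∑ i, ‖embed e (restr a (E i))‖})

/-- `b` is a normalized block basis of the unit vector basis `e`. -/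
def IsNormalizedBlockBasis {S : Type*} [NormedAddCommGroup S] [NormedSpace ℝ S] (e : ℕ → S)
    (b : ℕ → ℕ →₀ ℝ) : Prop :=
  (∀ k, b k ≠ 0) ∧ (∀ k, ∀ m ∈ (b k).support, ∀ n ∈ (b (k + 1)).support, m < n) ∧
  (∀ k, ‖embed e (b k)‖ = 1)

/-- The series `Σ g k` converges to `s` (convergence of partial sums). -/
def SeriesSum {S : Type*} [AddCommMonoid S] [TopologicalSpace S] (g : ℕ → S) (s : S) : Prop :=
  Tendsto (fun m => ∑ k ∈ Finset.range m, g k) atTop (𝓝 s)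

/-- `V` is isomorphic (linearly homeomorphic) to the S-sum `(Σₖ ⊕ X k)_S`,
where the S-sum consists of all `y : Π k, X k` such that `Σₖ ‖y k‖ e k` converges in `S`,
normed by `‖Σₖ ‖y k‖ e k‖`. -/
def IsoToSSum {S : Type*} [NormedAddCommGroup S] [NormedSpace ℝ S] (e : ℕ → S)
    (V : Type*) [NormedAddCommGroup V] [Module ℝ V]
    (X : ℕ → Type*) [∀ k, NormedAddCommGroup (X k)] [∀ k, Module ℝ (X k)] : Prop :=
  ∃ (T : V →ₗ[ℝ] Π k, X k) (A B : ℝ), 0 < A ∧ 0 < B ∧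
    (Set.range T = {y | ∃ s : S, SeriesSum (fun k => ‖y k‖ • e k) s}) ∧
    ∀ v : V, ∃ s : S, SeriesSum (fun k => ‖T v k‖ • e k) s ∧
      A * ‖v‖ ≤ ‖s‖ ∧ ‖s‖ ≤ B * ‖v‖

theorem one_lt_schF {r : ℕ} (hr : 2 ≤ r) : 1 < schF r := by
  have h : (2 : ℝ) ≤ r := by exact_mod_cast hr
  rw [schF, Real.lt_logb_iff_rpow_lt (by norm_num) (by linarith)]
  norm_num
  linarith

theorem schF_two_le {r : ℕ} (hr : 2 ≤ r) : schF (2 : ℕ) ≤ schF r := by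
  have h : (2 : ℝ) ≤ r := by exact_mod_cast hr
  unfold schF
  push_cast
  exact Real.logb_le_logb_of_le (by norm_num) (by norm_num) (by linarith)

theorem embed_eq_linearCombination {S : Type*} [NormedAddCommGroup S] [NormedSpace ℝ S]
    (e : ℕ → S) (a : ℕ →₀ ℝ) : embed e a = Finsupp.linearCombination ℝ e a := rfl

theorem restr_restr (a : ℕ →₀ ℝ) (E F : Finset ℕ) :
    restr (restr a E) F = restr a (E ∩ F) := by
  ext n
  simp only [restr, Finsupp.filter_apply, Finset.mem_inter]
  split_ifs <;> tauto

theorem restr_add (a b : ℕ →₀ ℝ) (E : Finset ℕ) :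
    restr (a + b) E = restr a E + restr b E :=
  Finsupp.filter_add

theorem restr_eq_zero {a : ℕ →₀ ℝ} {E : Finset ℕ} (h : ∀ n ∈ a.support, n ∉ E) :
    restr a E = 0 :=
  (Finsupp.filter_eq_zero_iff _ _).2 fun n hn => by
    by_contra hne
    exact h n (Finsupp.mem_support_iff.2 hne) hn

theorem restr_eq_self {a : ℕ →₀ ℝ} {E : Finset ℕ} (h : a.support ⊆ E) : restr a E = a :=
  (Finsupp.filter_eq_self_iff _ _).2 fun _ hn => h (Finsupp.mem_support_iff.2 hn)

theorem Succ.disjoint {r : ℕ} {E : Fin r → Finset ℕ} (hE : Succ E) {i j : Fin r} (hij : i ≠ j) :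
    Disjoint (E i) (E j) := by
  rw [Finset.disjoint_left]
  intro n hi hj
  rcases lt_or_gt_of_ne hij with h | h
  · exact lt_irrefl _ (hE i j h n hi n hj)
  · exact lt_irrefl _ (hE j i h n hj n hi)

section Schlumprecht

variable {S : Type*} [NormedAddCommGroup S] [NormedSpace ℝ S] {e : ℕ → S}

theorem sum_norm_embed_restr_le (e : ℕ → S) (a : ℕ →₀ ℝ) {r : ℕ} {E : Fin r → Finset ℕ}
    (hE : Succ E) :
    ∑ i, ‖embed e (restr a (E i))‖ ≤ ∑ m ∈ a.support, ‖a m • e m‖ := by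
  have hpart (i : Fin r) :
      ‖embed e (restr a (E i))‖ ≤ ∑ m ∈ a.support.filter (· ∈ E i), ‖a m • e m‖ := by
    have hs : embed e (restr a (E i)) = ∑ m ∈ a.support.filter (· ∈ E i), a m • e m := by
      rw [embed, Finsupp.sum, restr, Finsupp.support_filter]
      refine Finset.sum_congr rfl fun m hm => ?_
      rw [Finsupp.filter_apply_pos _ _ (Finset.mem_filter.1 hm).2]
    rw [hs]
    exact norm_sum_le _ _
  refine (Finset.sum_le_sum fun i _ => hpart i).trans ?_
  rw [← Finset.sum_biUnion]
  · refine Finset.sum_le_sum_of_subset_of_nonneg ?_ fun _ _ _ => norm_nonneg _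
    exact Finset.biUnion_subset.2 fun i _ => Finset.filter_subset _ _
  · intro i _ j _ hij
    exact Finset.disjoint_filter.2 fun n _ hn => Finset.disjoint_left.1 (hE.disjoint hij) hn

namespace IsSchlumprecht

/-- The admissible averages bounding the norm from below. -/
theorem inv_schF_mul_sum_le (hS : IsSchlumprecht S e) (a : ℕ →₀ ℝ) {r : ℕ} (hr : 2 ≤ r)
    {E : Fin r → Finset ℕ} (hE : Succ E) :
    (schF r)⁻¹ * ∑ i, ‖embed e (restr a (E i))‖ ≤ ‖embed e a‖ := by
  rw [hS.norm_eq a]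
  refine (le_csSup ?_ ?_).trans (le_max_right _ _)
  swap
  · exact ⟨r, hr, E, hE, rfl⟩
  refine ⟨∑ m ∈ a.support, ‖a m • e m‖, ?_⟩
  rintro _ ⟨r, hr, E, hE, rfl⟩
  refine (mul_le_of_le_one_left (Finset.sum_nonneg fun _ _ => norm_nonneg _)
    (inv_le_one_of_one_le₀ (one_lt_schF hr).le)).trans (sum_norm_embed_restr_le e a hE)

theorem abs_le_norm (hS : IsSchlumprecht S e) (a : ℕ →₀ ℝ) (i : ℕ) : |a i| ≤ ‖embed e a‖ := by
  rw [hS.norm_eq a]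
  refine le_trans (le_ciSup (f := fun i => |a i|) ?_ i) (le_max_left _ _)
  refine ⟨∑ m ∈ a.support, |a m|, ?_⟩
  rintro _ ⟨m, rfl⟩
  by_cases hm : m ∈ a.support
  · exact Finset.single_le_sum (f := fun m => |a m|) (fun _ _ => abs_nonneg _) hm
  · rw [Finsupp.notMem_support_iff] at hm
    simpa [hm] using Finset.sum_nonneg fun m (_ : m ∈ a.support) => abs_nonneg (a m)

theorem norm_le (hS : IsSchlumprecht S e) {a : ℕ →₀ ℝ} {M : ℝ} (hsup : ∀ i, |a i| ≤ M)
    (havg : ∀ r : ℕ, 2 ≤ r → ∀ E : Fin r → Finset ℕ, Succ E →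
      (schF r)⁻¹ * ∑ i, ‖embed e (restr a (E i))‖ ≤ M) :
    ‖embed e a‖ ≤ M := by
  rw [hS.norm_eq a]
  refine max_le (ciSup_le hsup) (csSup_le ?_ ?_)
  · exact ⟨_, 2, le_rfl, fun _ => ∅, fun _ _ _ _ h => by simp at h, rfl⟩
  · rintro _ ⟨r, hr, E, hE, rfl⟩
    exact havg r hr E hE

theorem norm_restr_le (hS : IsSchlumprecht S e) (a : ℕ →₀ ℝ) (E : Finset ℕ) :
    ‖embed e (restr a E)‖ ≤ ‖embed e a‖ := by
  refine hS.norm_le (fun i => ?_) fun r hr F hF => ?_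
  · by_cases hi : i ∈ E
    · rw [restr, Finsupp.filter_apply_pos _ _ hi]
      exact hS.abs_le_norm a i
    · rw [restr, Finsupp.filter_apply_neg _ _ hi, abs_zero]
      exact norm_nonneg _
  · simp only [restr_restr]
    exact hS.inv_schF_mul_sum_le a hr fun i j hij m hm n hn =>
      hF i j hij m (Finset.mem_inter.1 hm).2 n (Finset.mem_inter.1 hn).2

/-- In estimating the norm from above, only families that properly split the support matter. -/
theorem norm_le_of_split (hS : IsSchlumprecht S e) {a : ℕ →₀ ℝ} {M : ℝ} (hsup : ∀ i, |a i| ≤ M)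
    (hsplit : ∀ r : ℕ, 2 ≤ r → ∀ E : Fin r → Finset ℕ, Succ E →
      (∀ i, ¬ a.support ⊆ E i) → (schF r)⁻¹ * ∑ i, ‖embed e (restr a (E i))‖ ≤ M) :
    ‖embed e a‖ ≤ M := by
  have key : ‖embed e a‖ ≤ max M ((schF (2 : ℕ))⁻¹ * ‖embed e a‖) := by
    refine hS.norm_le (fun i => (hsup i).trans (le_max_left _ _)) fun r hr E hE => ?_
    by_cases h : ∀ i, ¬ a.support ⊆ E i
    · exact (hsplit r hr E hE h).trans (le_max_left _ _)
    · push Not at h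
      obtain ⟨i, hi⟩ := h
      refine le_trans ?_ (le_max_right _ _)
      rw [Finset.sum_eq_single i, restr_eq_self hi]
      · have := one_lt_schF le_rfl
        have := schF_two_le hr
        gcongr
      · intro j _ hj
        rw [restr_eq_zero fun n hn => Finset.disjoint_left.1 (hE.disjoint hj.symm) (hi hn)]
        simp [embed]
      · simp
  rcases le_max_iff.1 key with h | h
  · exact h
  · have h2 := inv_lt_one_of_one_lt₀ (one_lt_schF le_rfl)
    have h0 : ‖embed e a‖ ≤ 0 := by nlinarith [norm_nonneg (embed e a)]
    exact h0.trans ((abs_nonneg _).trans (hsup 0))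

end IsSchlumprecht

namespace IsNormalizedBlockBasis

variable {b : ℕ → ℕ →₀ ℝ}

theorem support_lt (hb : IsNormalizedBlockBasis e b) {i j : ℕ} (hij : i < j) :
    ∀ m ∈ (b i).support, ∀ n ∈ (b j).support, m < n := by
  induction j, hij using Nat.le_induction with
  | base => exact hb.2.1 i
  | succ j _ ih =>
    intro m hm n hn
    obtain ⟨p, hp⟩ := Finsupp.support_nonempty_iff.2 (hb.1 j)
    exact (ih m hm p hp).trans (hb.2.1 j p hp n hn)

theorem eq_of_mem_support (hb : IsNormalizedBlockBasis e b) {i j n : ℕ}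
    (hi : n ∈ (b i).support) (hj : n ∈ (b j).support) : i = j := by
  by_contra hij
  rcases lt_or_gt_of_ne hij with h | h
  · exact lt_irrefl _ (hb.support_lt h n hi n hj)
  · exact lt_irrefl _ (hb.support_lt h n hj n hi)

theorem restr_linearCombination (hb : IsNormalizedBlockBasis e b) (a : ℕ →₀ ℝ) (E : Finset ℕ) :
    restr (Finsupp.linearCombination ℝ b a) (E.biUnion fun j => (b j).support) =
      Finsupp.linearCombination ℝ b (restr a E) := by
  induction a using Finsupp.induction_linear with
  | zero => rw [restr_eq_zero (by simp), restr_eq_zero (by simp), map_zero]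
  | add x y hx hy => rw [map_add, restr_add, restr_add, map_add, hx, hy]
  | single j c =>
    rw [Finsupp.linearCombination_single]
    by_cases hj : j ∈ E
    · rw [restr_eq_self, restr_eq_self, Finsupp.linearCombination_single]
      · exact Finsupp.support_single_subset.trans (Finset.singleton_subset_iff.2 hj)
      · exact Finsupp.support_smul.trans
          (Finset.subset_biUnion_of_mem (fun j => (b j).support) hj)
    · rw [restr_eq_zero, restr_eq_zero, map_zero]
      · intro n hn hnE
        exact hj (Finset.mem_singleton.1 (Finsupp.support_single_subset hn) ▸ hnE)
      · intro n hn hnE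
        obtain ⟨i, hi, hni⟩ := Finset.mem_biUnion.1 hnE
        exact hj (hb.eq_of_mem_support hni (Finsupp.support_smul hn) ▸ hi)

theorem succ_biUnion_support (hb : IsNormalizedBlockBasis e b) {r : ℕ} {E : Fin r → Finset ℕ}
    (hE : Succ E) : Succ fun i => (E i).biUnion fun j => (b j).support := by
  intro i j hij m hm n hn
  obtain ⟨p, hp, hmp⟩ := Finset.mem_biUnion.1 hm
  obtain ⟨q, hq, hnq⟩ := Finset.mem_biUnion.1 hn
  exact hb.support_lt (hE i j hij p hp q hq) m hmp n hnq

theorem abs_le_norm (hb : IsNormalizedBlockBasis e b) (hS : IsSchlumprecht S e) (a : ℕ →₀ ℝ)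
    (i : ℕ) : |a i| ≤ ‖embed e (Finsupp.linearCombination ℝ b a)‖ := by
  have h := hS.norm_restr_le (Finsupp.linearCombination ℝ b a)
    (({i} : Finset ℕ).biUnion fun j => (b j).support)
  have hi : restr a {i} = Finsupp.single i (a i) := by
    ext n
    rw [restr, Finsupp.filter_apply, Finsupp.single_apply]
    by_cases hn : n = i
    · simp [hn]
    · simp [hn, Ne.symm hn]
  rw [hb.restr_linearCombination, hi, Finsupp.linearCombination_single,
    embed_eq_linearCombination, map_smul, ← embed_eq_linearCombination, norm_smul, hb.2.2,
    mul_one, Real.norm_eq_abs] at h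
  exact h

theorem norm_embed_le (hb : IsNormalizedBlockBasis e b) (hS : IsSchlumprecht S e) (a : ℕ →₀ ℝ) :
    ‖embed e a‖ ≤ ‖embed e (Finsupp.linearCombination ℝ b a)‖ := by
  induction hn : a.support.card using Nat.strong_induction_on generalizing a with
  | _ n ih =>
    subst hn
    refine hS.norm_le_of_split (hb.abs_le_norm hS a) fun r hr E hE hsub => ?_
    refine le_trans ?_ (hS.inv_schF_mul_sum_le (Finsupp.linearCombination ℝ b a) hr
      (hb.succ_biUnion_support hE))
    have := one_lt_schF hr
    gcongr with i
    rw [hb.restr_linearCombination]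
    refine ih _ (Finset.card_lt_card ?_) _ rfl
    rw [restr, Finsupp.support_filter, Finset.filter_ssubset]
    exact Finset.not_subset.1 (hsub i)

end IsNormalizedBlockBasis

end Schlumprecht

/-- Every normalized block basis `(y i)` of `(e i)` in the Schlumprecht space
dominates `(e i)`: `‖Σᵢ aᵢ yᵢ‖ ≥ ‖Σᵢ aᵢ eᵢ‖` for all finitely supported scalars. -/
theorem block_basis_dominates {S : Type*} [NormedAddCommGroup S] [NormedSpace ℝ S]
    [CompleteSpace S] (e : ℕ → S) (hS : IsSchlumprecht S e)
    (b : ℕ → (ℕ →₀ ℝ)) (hb : IsNormalizedBlockBasis e b) (a : ℕ →₀ ℝ) :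
    ‖embed e a‖ ≤ ‖a.sum fun i c => c • embed e (b i)‖ := by
  have h := hb.norm_embed_le hS a
  have hsum : embed e (Finsupp.linearCombination ℝ b a) =
      a.sum fun i c => c • embed e (b i) := by
    rw [embed_eq_linearCombination, Finsupp.linearCombination_apply ℝ (v := b), map_finsuppSum]
    simp only [map_smul, embed_eq_linearCombination]
  rwa [hsum] at h
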